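/- arXiv:2510.06318 — 8 statements merged into one kernel-verified Lean document; each statement's English description precedes it below -/
import Mathlib

section
/- Let H be a finite-dimensional complex inner product space, let ψ, φ ∈ H, and let g, E be linear maps from H to H such that g is unitary, g ψ = ψ, g φ = φ, and E ∘ g = -(g ∘ E). Then the inner product ⟪φ, E ψ⟫ equals 0. -/
open scoped InnerProductSpace

/-- An operator `E` that anticommutes with a unitary `g` fixing both codewords `ψ` and `φ`
has vanishing matrix element `⟪φ, E ψ⟫` between them. -/
theorem stmt_0 {H : Type*} [NormedAddCommGroup H] [InnerProductSpace ℂ H]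
    [FiniteDimensional ℂ H]
    (ψ φ : H) (g E : H →ₗ[ℂ] H)
    (hg_bij : Function.Bijective g)
    (hg_inner : ∀ u v : H, ⟪g u, g v⟫_ℂ = ⟪u, v⟫_ℂ)
    (hψ : g ψ = ψ) (hφ : g φ = φ)
    (hanti : E ∘ₗ g = -(g ∘ₗ E)) :
    ⟪φ, E ψ⟫_ℂ = 0 := by
  have hE : E ψ = -g (E ψ) := by
    simpa [hψ] using LinearMap.congr_fun hanti ψ
  have h : ⟪φ, E ψ⟫_ℂ = -⟪φ, E ψ⟫_ℂ :=
    calc ⟪φ, E ψ⟫_ℂ = ⟪φ, -g (E ψ)⟫_ℂ := by rw [← hE]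
      _ = -⟪g φ, g (E ψ)⟫_ℂ := by rw [inner_neg_right, hφ]
      _ = -⟪φ, E ψ⟫_ℂ := by rw [hg_inner]
  exact self_eq_neg.mp h
end

section
/- Let H be a complex inner product space, let s₁, s₂ ∈ H be unit vectors with ⟪s₁, s₂⟫ ≠ 0, let a, b ∈ ℂ, and set ψ = a • s₁ + b • s₂. Writing ρᵢ = |sᵢ⟩⟨sᵢ| for the rank-one operator u ↦ ⟪sᵢ, u⟫ • sᵢ, one has |ψ⟩⟨ψ| = |a|² • ρ₁ + |b|² • ρ₂ + (a * conj b / ⟪s₁, s₂⟫) • (ρ₁ ∘ ρ₂) + (conj a * b / ⟪s₂, s₁⟫) • (ρ₂ ∘ ρ₁). -/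
open scoped InnerProductSpace

/-- The rank-one operator `|v⟩⟨w| : u ↦ ⟪w, u⟫ • v`. -/
noncomputable def ketbra {H : Type*} [NormedAddCommGroup H] [InnerProductSpace ℂ H]
    (v w : H) : H →ₗ[ℂ] H where
  toFun u := (⟪w, u⟫_ℂ) • v
  map_add' u₁ u₂ := by simp [inner_add_right, add_smul]
  map_smul' c u := by simp [inner_smul_right, smul_smul]

theorem ketbra_comp_ketbra {H : Type*} [NormedAddCommGroup H] [InnerProductSpace ℂ H]
    (v w x y : H) : ketbra v w ∘ₗ ketbra x y = ⟪w, x⟫_ℂ • ketbra v y := by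
  ext u
  simp [ketbra, smul_smul, mul_comm]

/-- Density-matrix expansion for a superposition `ψ = a • s₁ + b • s₂` of two
non-orthogonal unit (stabilizer) states. -/
theorem stmt_2 {H : Type*} [NormedAddCommGroup H] [InnerProductSpace ℂ H]
    (s₁ s₂ : H) (h₁ : ‖s₁‖ = 1) (h₂ : ‖s₂‖ = 1)
    (hov : ⟪s₁, s₂⟫_ℂ ≠ 0) (a b : ℂ) :
    ketbra (a • s₁ + b • s₂) (a • s₁ + b • s₂)
      = ((‖a‖ : ℂ) ^ 2) • ketbra s₁ s₁ + ((‖b‖ : ℂ) ^ 2) • ketbra s₂ s₂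
        + (a * (starRingEnd ℂ) b / ⟪s₁, s₂⟫_ℂ) • (ketbra s₁ s₁ ∘ₗ ketbra s₂ s₂)
        + ((starRingEnd ℂ) a * b / ⟪s₂, s₁⟫_ℂ) • (ketbra s₂ s₂ ∘ₗ ketbra s₁ s₁) := by
  have hov' : ⟪s₂, s₁⟫_ℂ ≠ 0 := fun h => hov (inner_eq_zero_symm.mp h)
  rw [ketbra_comp_ketbra, ketbra_comp_ketbra, smul_smul, smul_smul,
    div_mul_cancel₀ _ hov, div_mul_cancel₀ _ hov', ← Complex.conj_mul', ← Complex.conj_mul']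
  ext u
  simp only [ketbra, LinearMap.coe_mk, AddHom.coe_mk, LinearMap.add_apply, LinearMap.smul_apply,
    inner_add_left, inner_smul_left]
  module
end

section
/- For n : ℕ and x z x' z' : Fin n → ZMod 2, the Pauli strings satisfy P(x,z) * P(x',z') = (-1)^(⟨(x,z),(x',z')⟩) • (P(x',z') * P(x,z)), where ⟨(x,z),(x',z')⟩ = Σ_i (x i * z' i + z i * x' i) computed in ZMod 2 (the sign is -1 when this symplectic form is 1 and +1 when it is 0). In particular, any two Pauli strings either commute or anticommute. -/
open Matrix

noncomputable def PauliX : Matrix (Fin 2) (Fin 2) ℂ := !![0, 1; 1, 0]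
noncomputable def PauliZ : Matrix (Fin 2) (Fin 2) ℂ := !![1, 0; 0, -1]

/-- The `n`-qubit Pauli string `P(x,z)`, the `n`-fold Kronecker product over `i` of
`X^(x i) * Z^(z i)`, viewed as a `2^n × 2^n` complex matrix. -/
noncomputable def pauliString (n : ℕ) (x z : Fin n → ZMod 2) :
    Matrix (Fin (2 ^ n)) (Fin (2 ^ n)) ℂ :=
  Matrix.reindex finFunctionFinEquiv finFunctionFinEquiv
    (Matrix.of fun a b : Fin n → Fin 2 =>
      ∏ i, (PauliX ^ (x i).val * PauliZ ^ (z i).val) (a i) (b i))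

/-- The Kronecker product of a family of matrices is multiplicative. -/
theorem of_prod_mul_of_prod {ι κ R : Type*} [Fintype ι] [DecidableEq ι] [Fintype κ]
    [CommSemiring R] (A B : ι → Matrix κ κ R) :
    (Matrix.of fun a b : ι → κ => ∏ i, A i (a i) (b i)) *
        (Matrix.of fun a b : ι → κ => ∏ i, B i (a i) (b i))
      = Matrix.of fun a b : ι → κ => ∏ i, (A i * B i) (a i) (b i) := by
  ext a b
  simp only [Matrix.mul_apply, Matrix.of_apply, ← Finset.prod_mul_distrib, Fintype.prod_sum]

theorem neg_one_pow_val_add (a b : ZMod 2) :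
    (-1 : ℂ) ^ (a + b).val = (-1) ^ a.val * (-1) ^ b.val := by
  rw [← pow_add, ZMod.val_add, ← neg_one_pow_eq_pow_mod_two]

theorem neg_one_pow_val_sum {ι : Type*} (s : Finset ι) (f : ι → ZMod 2) :
    (-1 : ℂ) ^ (∑ i ∈ s, f i).val = ∏ i ∈ s, (-1) ^ (f i).val := by
  classical
  induction s using Finset.induction_on with
  | empty => simp
  | insert i s hi ih => rw [Finset.sum_insert hi, Finset.prod_insert hi, neg_one_pow_val_add, ih]

/-- The commutation relation for single-qubit Pauli matrices. -/
theorem pauli_mul_pauli (x z x' z' : ZMod 2) :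
    (PauliX ^ x.val * PauliZ ^ z.val) * (PauliX ^ x'.val * PauliZ ^ z'.val)
      = ((-1 : ℂ) ^ (x * z' + z * x').val) •
        ((PauliX ^ x'.val * PauliZ ^ z'.val) * (PauliX ^ x.val * PauliZ ^ z.val)) := by
  have hone : (1 : ZMod 2).val = 1 := rfl
  have htwo : (1 + 1 : ZMod 2) = 0 := rfl
  have h : ∀ a : ZMod 2, a = 0 ∨ a = 1 := by decide
  rcases h x with rfl | rfl <;> rcases h z with rfl | rfl <;>
    rcases h x' with rfl | rfl <;> rcases h z' with rfl | rfl <;>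
    simp [hone, htwo, PauliX, PauliZ]

/-- Two Pauli strings commute or anticommute, with sign given by the symplectic form
`Σ_i (x i * z' i + z i * x' i)` computed in `ZMod 2`. -/
theorem stmt_6 (n : ℕ) (x z x' z' : Fin n → ZMod 2) :
    pauliString n x z * pauliString n x' z'
      = ((-1 : ℂ) ^ ((∑ i, (x i * z' i + z i * x' i) : ZMod 2)).val) •
        (pauliString n x' z' * pauliString n x z) := by
  simp only [pauliString, Matrix.reindex_apply, Matrix.submatrix_mul_equiv, of_prod_mul_of_prod,
    pauli_mul_pauli (x _), neg_one_pow_val_sum]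
  ext a b
  simp [Finset.prod_mul_distrib]
end

section
/- Let n k : ℕ with k ≤ n, and let S be a finite commutative subgroup of the multiplicative group of invertible 2^n × 2^n complex matrices such that every element of S has the form ε • P(x,z) with ε ∈ {1, -1} and x z : Fin n → ZMod 2, such that the matrix -1 ∉ S, and such that |S| = 2^(n-k). Then the complex subspace {v : Fin (2^n) → ℂ | ∀ s ∈ S, s.mulVec v = v} has dimension 2^k. -/
open Matrix

/-- The subspace of vectors fixed by every element of a subgroup `S` of invertible
`2^n × 2^n` matrices: the code subspace of the stabilizer group `S`. -/
noncomputable def fixedSpace (n : ℕ) (S : Subgroup (Matrix.GeneralLinearGroup (Fin (2 ^ n)) ℂ)) :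
    Submodule ℂ (Fin (2 ^ n) → ℂ) where
  carrier := {v | ∀ g ∈ S,
    Matrix.mulVec (g : Matrix (Fin (2 ^ n)) (Fin (2 ^ n)) ℂ) v = v}
  add_mem' := by
    intro u v hu hv g hg
    simp only [Matrix.mulVec_add, hu g hg, hv g hg]
  zero_mem' := by
    intro g hg
    simp
  smul_mem' := by
    intro c v hv g hg
    simp only [Matrix.mulVec_smul, hv g hg]

theorem trace_pauliString (n : ℕ) (x z : Fin n → ZMod 2) :
    (pauliString n x z).trace =
      ∏ i, (PauliX ^ (x i).val * PauliZ ^ (z i).val).trace := by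
  simp only [Matrix.trace, Matrix.diag, pauliString, Fintype.prod_sum]
  exact Equiv.sum_comp finFunctionFinEquiv.symm
    fun a : Fin n → Fin 2 => ∏ i, (PauliX ^ (x i).val * PauliZ ^ (z i).val) (a i) (a i)

theorem pauliString_zero (n : ℕ) : pauliString n 0 0 = 1 := by
  have h : (Matrix.of fun a b : Fin n → Fin 2 =>
      ∏ i : Fin n, (1 : Matrix (Fin 2) (Fin 2) ℂ) (a i) (b i)) = 1 := by
    ext a b
    simp [Matrix.one_apply, Finset.prod_ite_zero, funext_iff]
  simp [pauliString, h]

theorem trace_pauliX_pow_mul_pauliZ_pow_eq_zero {x z : ZMod 2} (h : ¬(x = 0 ∧ z = 0)) :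
    (PauliX ^ x.val * PauliZ ^ z.val).trace = 0 := by
  fin_cases x <;> fin_cases z
  · exact absurd ⟨rfl, rfl⟩ h
  all_goals simp [ZMod.val, PauliX, PauliZ, Matrix.trace_fin_two]

theorem trace_pauliString_eq_zero {n : ℕ} {x z : Fin n → ZMod 2} (h : ¬(x = 0 ∧ z = 0)) :
    (pauliString n x z).trace = 0 := by
  obtain ⟨i, hi⟩ : ∃ i, ¬(x i = 0 ∧ z i = 0) := by
    by_contra! hc
    exact h ⟨funext fun i => (hc i).1, funext fun i => (hc i).2⟩
  rw [trace_pauliString]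
  exact Finset.prod_eq_zero (Finset.mem_univ i) (trace_pauliX_pow_mul_pauliZ_pow_eq_zero hi)

/-- The action of a matrix group on column vectors. -/
noncomputable def mulVecRepresentation {m : Type*} [Fintype m] [DecidableEq m]
    (S : Subgroup (Matrix.GeneralLinearGroup m ℂ)) : Representation ℂ S (m → ℂ) :=
  (Matrix.toLinAlgEquiv' : Matrix m m ℂ ≃ₐ[ℂ] _).toMonoidHom.comp
    ((Units.coeHom (Matrix m m ℂ)).comp S.subtype)

theorem character_mulVecRepresentation {m : Type*} [Fintype m] [DecidableEq m]
    (S : Subgroup (Matrix.GeneralLinearGroup m ℂ)) (g : S) :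
    (mulVecRepresentation S).character g =
      ((g : Matrix.GeneralLinearGroup m ℂ) : Matrix m m ℂ).trace :=
  Matrix.trace_toLin'_eq _

theorem invariants_mulVecRepresentation (n : ℕ)
    (S : Subgroup (Matrix.GeneralLinearGroup (Fin (2 ^ n)) ℂ)) :
    (mulVecRepresentation S).invariants = fixedSpace n S := by
  ext v
  exact Subtype.forall

/-- The dimension of the fixed space of a finite matrix group, times the order of the group,
is the sum of the traces of its elements. -/
theorem card_mul_finrank_fixedSpace (n : ℕ)
    (S : Subgroup (Matrix.GeneralLinearGroup (Fin (2 ^ n)) ℂ)) [Fintype S] :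
    (Nat.card S : ℂ) * Module.finrank ℂ (fixedSpace n S) =
      ∑ g : S, ((g : Matrix.GeneralLinearGroup (Fin (2 ^ n)) ℂ) :
        Matrix (Fin (2 ^ n)) (Fin (2 ^ n)) ℂ).trace := by
  have h0 : (Nat.card S : ℂ) ≠ 0 := Nat.cast_ne_zero.mpr Nat.card_pos.ne'
  let : Invertible (Nat.card S : ℂ) := invertibleOfNonzero h0
  have h := Representation.card_inv_mul_sum_char_eq_finrank (mulVecRepresentation S)
  simp only [character_mulVecRepresentation] at h
  rw [← invariants_mulVecRepresentation, ← h, mul_inv_cancel_left₀ h0]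

/-- An `[[n,k]]` Pauli stabilizer group (commutative, consisting of signed Pauli
strings, not containing `-1`, of order `2^(n-k)`) has a code subspace of
dimension `2^k`. -/
theorem stmt_8 (n k : ℕ) (hk : k ≤ n)
    (S : Subgroup (Matrix.GeneralLinearGroup (Fin (2 ^ n)) ℂ))
    (hcomm : ∀ g ∈ S, ∀ h ∈ S, g * h = h * g)
    (hpauli : ∀ g ∈ S, ∃ (ε : ℂ) (x z : Fin n → ZMod 2),
        (ε = 1 ∨ ε = -1) ∧
          (g : Matrix (Fin (2 ^ n)) (Fin (2 ^ n)) ℂ) = ε • pauliString n x z)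
    (hneg : ∀ g ∈ S, (g : Matrix (Fin (2 ^ n)) (Fin (2 ^ n)) ℂ) ≠ -1)
    (hcard : Nat.card S = 2 ^ (n - k)) :
    Module.finrank ℂ (fixedSpace n S) = 2 ^ k := by
  have : Finite S := Nat.finite_of_card_ne_zero (by rw [hcard]; positivity)
  let := Fintype.ofFinite S
  have htrace : ∀ g : S, g ≠ 1 → ((g : Matrix.GeneralLinearGroup (Fin (2 ^ n)) ℂ) :
      Matrix (Fin (2 ^ n)) (Fin (2 ^ n)) ℂ).trace = 0 := by
    rintro ⟨g, hg⟩ hg1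
    obtain ⟨ε, x, z, hε, hgP⟩ := hpauli g hg
    have hxz : ¬(x = 0 ∧ z = 0) := by
      rintro ⟨rfl, rfl⟩
      rw [pauliString_zero] at hgP
      rcases hε with rfl | rfl
      · exact hg1 (Subtype.ext (Units.ext (by simpa using hgP)))
      · exact hneg g hg (by simpa using hgP)
    simp [hgP, Matrix.trace_smul, trace_pauliString_eq_zero hxz]
  have h := card_mul_finrank_fixedSpace n S
  rw [Finset.sum_eq_single 1 (fun g _ => htrace g) (by simp), hcard, OneMemClass.coe_one,
    Units.val_one, Matrix.trace_one, Fintype.card_fin] at h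
  have h' : 2 ^ (n - k) * Module.finrank ℂ (fixedSpace n S) = 2 ^ (n - k) * 2 ^ k := by
    rw [pow_sub_mul_pow 2 hk]
    exact_mod_cast h
  exact Nat.eq_of_mul_eq_mul_left (by positivity) h'
end

section
/- Let n : ℕ, let S be a finite commutative subgroup of the multiplicative group of invertible 2^n × 2^n complex matrices whose every element has the form ε • P(x,z) with ε ∈ {1, -1}, with -1 ∉ S, and let ψ : Fin (2^n) → ℂ satisfy s.mulVec ψ = ψ for every s ∈ S. If Q = ε' • P(x',z') is a signed Pauli string such that the expectation value (star ψ) ⬝ᵥ (Q.mulVec ψ) ≠ 0, then Q commutes with every element of S, i.e. Q * s = s * Q for all s ∈ S. -/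
open Matrix

/-- The Kronecker product of a finite family of square matrices. -/
def piKronecker {ι m R : Type*} [Fintype ι] [CommSemiring R] (A : ι → Matrix m m R) :
    Matrix (ι → m) (ι → m) R :=
  Matrix.of fun a b => ∏ i, A i (a i) (b i)

section PiKronecker

variable {ι m R : Type*} [Fintype ι]

theorem piKronecker_mul [DecidableEq ι] [Fintype m] [CommSemiring R] (A B : ι → Matrix m m R) :
    piKronecker A * piKronecker B = piKronecker fun i => A i * B i := by
  ext a b
  simp only [piKronecker, Matrix.mul_apply, Matrix.of_apply, ← Finset.prod_mul_distrib,
    Finset.prod_univ_sum, Fintype.piFinset_univ]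

theorem piKronecker_one [DecidableEq m] [CommSemiring R] :
    piKronecker (fun _ : ι => (1 : Matrix m m R)) = 1 := by
  classical
  ext a b
  simp [piKronecker, Matrix.one_apply, Finset.prod_ite_zero, funext_iff]

theorem piKronecker_smul [CommSemiring R] (c : ι → R) (A : ι → Matrix m m R) :
    piKronecker (fun i => c i • A i) = (∏ i, c i) • piKronecker A := by
  ext a b
  simp [piKronecker, Finset.prod_mul_distrib]

theorem conjTranspose_piKronecker [CommSemiring R] [StarRing R] (A : ι → Matrix m m R) :
    (piKronecker A)ᴴ = piKronecker fun i => (A i)ᴴ := by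
  ext a b
  simp [piKronecker, Matrix.conjTranspose_apply]

end PiKronecker

theorem pauliString_eq_reindex_piKronecker (n : ℕ) (x z : Fin n → ZMod 2) :
    pauliString n x z = Matrix.reindexAlgEquiv ℂ ℂ finFunctionFinEquiv
      (piKronecker fun i => PauliX ^ (x i).val * PauliZ ^ (z i).val) := rfl

theorem pauli_conjTranspose_mul_self (x z : ZMod 2) :
    (PauliX ^ x.val * PauliZ ^ z.val)ᴴ * (PauliX ^ x.val * PauliZ ^ z.val) = 1 := by
  have hX : PauliXᴴ * PauliX = 1 := by
    ext i j
    fin_cases i <;> fin_cases j <;> simp [PauliX, Matrix.mul_apply]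
  have hZ : PauliZᴴ * PauliZ = 1 := by
    ext i j
    fin_cases i <;> fin_cases j <;> simp [PauliZ, Matrix.mul_apply]
  exact (mul_mem (pow_mem (Matrix.mem_unitaryGroup_iff'.2 hX) _)
    (pow_mem (Matrix.mem_unitaryGroup_iff'.2 hZ) _) :
      PauliX ^ x.val * PauliZ ^ z.val ∈ Matrix.unitaryGroup (Fin 2) ℂ).1

theorem pauli_mul_comm_up_to_sign (x z x' z' : ZMod 2) :
    ∃ c : ℂ, (c = 1 ∨ c = -1) ∧
      (PauliX ^ x.val * PauliZ ^ z.val) * (PauliX ^ x'.val * PauliZ ^ z'.val) =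
        c • ((PauliX ^ x'.val * PauliZ ^ z'.val) * (PauliX ^ x.val * PauliZ ^ z.val)) := by
  refine ⟨(-1) ^ (x.val * z'.val + z.val * x'.val), neg_one_pow_eq_or ℂ _, ?_⟩
  fin_cases x <;> fin_cases z <;> fin_cases x' <;> fin_cases z' <;>
    simp [PauliX, PauliZ, ZMod.val]

theorem pauliString_conjTranspose_mul_self (n : ℕ) (x z : Fin n → ZMod 2) :
    (pauliString n x z)ᴴ * pauliString n x z = 1 := by
  have h : (pauliString n x z)ᴴ = Matrix.reindexAlgEquiv ℂ ℂ finFunctionFinEquiv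
      (piKronecker fun i => PauliX ^ (x i).val * PauliZ ^ (z i).val)ᴴ := rfl
  rw [h, pauliString_eq_reindex_piKronecker, ← map_mul, conjTranspose_piKronecker,
    piKronecker_mul]
  simp only [pauli_conjTranspose_mul_self, piKronecker_one, map_one]

theorem pauliString_mul_comm_up_to_sign (n : ℕ) (x z x' z' : Fin n → ZMod 2) :
    ∃ c : ℂ, (c = 1 ∨ c = -1) ∧
      pauliString n x z * pauliString n x' z' =
        c • (pauliString n x' z' * pauliString n x z) := by
  choose c hc h using fun i => pauli_mul_comm_up_to_sign (x i) (z i) (x' i) (z' i)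
  refine ⟨∏ i, c i, ?_, ?_⟩
  · exact Finset.prod_induction c (fun c => c = 1 ∨ c = -1)
      (by rintro a b (rfl | rfl) (rfl | rfl) <;> simp) (Or.inl rfl) fun i _ => hc i
  · simp only [pauliString_eq_reindex_piKronecker, ← map_mul, piKronecker_mul, h,
      piKronecker_smul, map_smul]

/-- If `A` is an isometry fixing `v` and anticommuting with `B`, then the expectation value of
`B` on `v` vanishes. -/
theorem dotProduct_mulVec_eq_zero_of_anticommute {m : Type*} [Fintype m] [DecidableEq m]
    {A B : Matrix m m ℂ} {v : m → ℂ} (hA : Aᴴ * A = 1) (hv : A *ᵥ v = v)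
    (hAB : B * A = -(A * B)) : star v ⬝ᵥ B *ᵥ v = 0 := by
  have hv' : Aᴴ *ᵥ v = v := by
    conv_lhs => rw [← hv]
    rw [Matrix.mulVec_mulVec, hA, Matrix.one_mulVec]
  have hstar : star v ᵥ* A = star v := by
    conv_rhs => rw [← hv', Matrix.star_mulVec, Matrix.conjTranspose_conjTranspose]
  have h : star v ⬝ᵥ B *ᵥ v = -(star v ⬝ᵥ B *ᵥ v) := by
    conv_lhs => rw [← hv, Matrix.mulVec_mulVec, hAB, Matrix.neg_mulVec, dotProduct_neg,
      ← Matrix.mulVec_mulVec, Matrix.dotProduct_mulVec, hv, hstar]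
  exact self_eq_neg.1 h

/-- A signed Pauli string with nonzero expectation value on a state stabilized by a
Pauli stabilizer group `S` must commute with every element of `S`. -/
theorem stmt_9 (n : ℕ)
    (S : Subgroup (Matrix.GeneralLinearGroup (Fin (2 ^ n)) ℂ)) (hfin : Finite S)
    (hcomm : ∀ g ∈ S, ∀ h ∈ S, g * h = h * g)
    (hpauli : ∀ g ∈ S, ∃ (ε : ℂ) (x z : Fin n → ZMod 2),
        (ε = 1 ∨ ε = -1) ∧
          (g : Matrix (Fin (2 ^ n)) (Fin (2 ^ n)) ℂ) = ε • pauliString n x z)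
    (hneg : ∀ g ∈ S, (g : Matrix (Fin (2 ^ n)) (Fin (2 ^ n)) ℂ) ≠ -1)
    (ψ : Fin (2 ^ n) → ℂ)
    (hψ : ∀ g ∈ S, Matrix.mulVec (g : Matrix (Fin (2 ^ n)) (Fin (2 ^ n)) ℂ) ψ = ψ)
    (Q : Matrix (Fin (2 ^ n)) (Fin (2 ^ n)) ℂ)
    (ε' : ℂ) (hε' : ε' = 1 ∨ ε' = -1) (x' z' : Fin n → ZMod 2)
    (hQ : Q = ε' • pauliString n x' z')
    (hexp : (star ψ) ⬝ᵥ (Q.mulVec ψ) ≠ 0) :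
    ∀ g ∈ S, Q * (g : Matrix (Fin (2 ^ n)) (Fin (2 ^ n)) ℂ)
      = (g : Matrix (Fin (2 ^ n)) (Fin (2 ^ n)) ℂ) * Q := by
  intro g hg
  obtain ⟨ε, x, z, hε, hgP⟩ := hpauli g hg
  obtain ⟨c, hc, hcomm'⟩ := pauliString_mul_comm_up_to_sign n x' z' x z
  have hQg : Q * (g : Matrix (Fin (2 ^ n)) (Fin (2 ^ n)) ℂ) =
      c • ((g : Matrix (Fin (2 ^ n)) (Fin (2 ^ n)) ℂ) * Q) := by
    rw [hQ, hgP]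
    simp only [smul_mul_assoc, mul_smul_comm, hcomm']
    simp only [smul_smul]
    congr 1
    ring
  rcases hc with rfl | rfl
  · rw [hQg, one_smul]
  · refine absurd (dotProduct_mulVec_eq_zero_of_anticommute ?_ (hψ g hg) ?_) hexp
    · rw [hgP, Matrix.conjTranspose_smul, smul_mul_smul_comm,
        pauliString_conjTranspose_mul_self]
      rcases hε with rfl | rfl <;> simp
    · rw [hQg, neg_one_smul]
end

section
/- Let K a b : ℕ, let ρ : Fin K → Matrix (Fin a) (Fin a) ℂ, χ : Matrix (Fin b) (Fin b) ℂ, p : Fin K → ℂ, and set ρ_A := Matrix.blockDiagonal (fun α => p α • ((ρ α) ⊗ₖ χ)). Then for every m : ℕ, trace (ρ_A ^ m) = (Σ_α (p α)^m * trace ((ρ α)^m)) * trace (χ ^ m). -/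
open Matrix
open scoped Kronecker

theorem Matrix.kronecker_pow {R m n : Type*} [CommSemiring R] [Fintype m] [Fintype n]
    [DecidableEq m] [DecidableEq n] (A : Matrix m m R) (B : Matrix n n R) (k : ℕ) :
    (A ⊗ₖ B) ^ k = (A ^ k) ⊗ₖ (B ^ k) := by
  induction k with
  | zero => simp
  | succ k ih => rw [pow_succ, pow_succ, pow_succ, ih, mul_kronecker_mul]

/-- Rényi-trace Ryu–Takayanagi factorization: for a block-diagonal state
`ρ_A = ⊕_α p α • (ρ α ⊗ₖ χ)`, the trace of every power factorizes into a bulk part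
and an area part. -/
theorem stmt_11 (K a b : ℕ) (ρ : Fin K → Matrix (Fin a) (Fin a) ℂ)
    (χ : Matrix (Fin b) (Fin b) ℂ) (p : Fin K → ℂ)
    (ρA : Matrix ((Fin a × Fin b) × Fin K) ((Fin a × Fin b) × Fin K) ℂ)
    (hρA : ρA = Matrix.blockDiagonal (fun α => p α • ((ρ α) ⊗ₖ χ))) :
    ∀ m : ℕ, Matrix.trace (ρA ^ m)
      = (∑ α, (p α) ^ m * Matrix.trace ((ρ α) ^ m)) * Matrix.trace (χ ^ m) := by
  intro m
  rw [hρA, ← blockDiagonal_pow, trace_blockDiagonal, Finset.sum_mul]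
  refine Finset.sum_congr rfl fun α _ => ?_
  rw [Pi.pow_apply, smul_pow, trace_smul, kronecker_pow, trace_kronecker, smul_eq_mul, mul_assoc]
end

section
/- Let K a b : ℕ, let p : Fin K → ℝ be nonnegative with Σ_α p α = 1, let ρ : Fin K → Matrix (Fin a) (Fin a) ℂ be density matrices and χ : Matrix (Fin b) (Fin b) ℂ a density matrix, and set ρ_A := Matrix.blockDiagonal (fun α => (p α : ℂ) • ((ρ α) ⊗ₖ χ)). Then ρ_A is a density matrix and S(ρ_A) = Σ_α Real.negMulLog (p α) + Σ_α p α * S(ρ α) + S(χ). -/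
open Matrix
open scoped Kronecker ComplexOrder

/-- The von Neumann entropy of a Hermitian matrix: `S(ρ) = Σ_i -λ_i log λ_i` over the
eigenvalues `λ_i` counted with multiplicity. -/
noncomputable def vnEntropy {m : Type*} [Fintype m] [DecidableEq m]
    {ρ : Matrix m m ℂ} (hρ : ρ.IsHermitian) : ℝ :=
  ∑ i, Real.negMulLog (hρ.eigenvalues i)

/-- The entropy of a Hermitian matrix that is similar to a real diagonal matrix can be computed
from the diagonal entries. -/
theorem vnEntropy_eq_of_eq_mul_diagonal_mul {m : Type*} [Fintype m] [DecidableEq m]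
    {M U V : Matrix m m ℂ} (hM : M.IsHermitian) (d : m → ℝ)
    (h : M = U * diagonal (fun i => (d i : ℂ)) * V) (hVU : V * U = 1) :
    vnEntropy hM = ∑ i, Real.negMulLog (d i) := by
  have hchar : M.charpoly = ∏ i, (Polynomial.X - Polynomial.C (d i : ℂ)) := by
    rw [h, charpoly_mul_comm, ← mul_assoc, hVU, one_mul, charpoly_diagonal]
  have hroots : Finset.univ.val.map (fun i => (hM.eigenvalues i : ℂ))
      = Finset.univ.val.map (fun i => (d i : ℂ)) := by
    have := congrArg Polynomial.roots (hM.charpoly_eq.symm.trans hchar)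
    simpa [Polynomial.roots_prod, Finset.prod_ne_zero_iff, Polynomial.X_sub_C_ne_zero,
      Multiset.bind_singleton] using this
  have hsum := congrArg (fun s => (s.map (fun z : ℂ => Real.negMulLog z.re)).sum) hroots
  simpa [vnEntropy, Multiset.map_map, Function.comp_def] using hsum

theorem sum_eigenvalues_eq_one_of_trace_eq_one {m : Type*} [Fintype m] [DecidableEq m]
    {M : Matrix m m ℂ} (hM : M.IsHermitian) (h : M.trace = 1) :
    ∑ i, hM.eigenvalues i = 1 := by
  rw [hM.trace_eq_sum_eigenvalues] at h
  exact Complex.ofReal_injective (by simpa using h)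

theorem blockDiagonal_smul_kronecker_eq_mul_diagonal_mul
    {k m n : Type*} [Fintype k] [DecidableEq k] [Fintype m] [DecidableEq m] [Fintype n]
    [DecidableEq n] (p : k → ℝ) {ρ : k → Matrix m m ℂ} {χ : Matrix n n ℂ}
    (hρ : ∀ α, (ρ α).IsHermitian) (hχ : χ.IsHermitian) :
    ∃ U : Matrix ((m × n) × k) ((m × n) × k) ℂ, Uᴴ * U = 1 ∧
      blockDiagonal (fun α => (p α : ℂ) • (ρ α ⊗ₖ χ)) =
        U * diagonal (fun i => ((p i.2 * ((hρ i.2).eigenvalues i.1.1 *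
          hχ.eigenvalues i.1.2) : ℝ) : ℂ)) * Uᴴ := by
  refine ⟨blockDiagonal fun α =>
    ((hρ α).eigenvectorUnitary : Matrix m m ℂ) ⊗ₖ (hχ.eigenvectorUnitary : Matrix n n ℂ), ?_, ?_⟩
  · rw [blockDiagonal_conjTranspose, ← blockDiagonal_mul, ← blockDiagonal_one]
    congr 1
    funext α
    rw [conjTranspose_kronecker, ← mul_kronecker_mul, ← star_eq_conjTranspose,
      ← star_eq_conjTranspose, Unitary.coe_star_mul_self, Unitary.coe_star_mul_self,
      one_kronecker_one, Pi.one_apply]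
  · rw [blockDiagonal_conjTranspose, ← blockDiagonal_diagonal (fun α (ij : m × n) =>
      ((p α * ((hρ α).eigenvalues ij.1 * hχ.eigenvalues ij.2) : ℝ) : ℂ)),
      ← blockDiagonal_mul, ← blockDiagonal_mul]
    congr 1
    funext α
    have hdiag : diagonal (fun ij : m × n =>
        ((p α * ((hρ α).eigenvalues ij.1 * hχ.eigenvalues ij.2) : ℝ) : ℂ)) =
        (p α : ℂ) • (diagonal (fun i => ((hρ α).eigenvalues i : ℂ)) ⊗ₖ
          diagonal (fun j => (hχ.eigenvalues j : ℂ))) := by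
      rw [diagonal_kronecker_diagonal, ← diagonal_smul]
      congr 1
      funext ij
      simp
    rw [hdiag, conjTranspose_kronecker, mul_smul_comm, smul_mul_assoc, ← mul_kronecker_mul,
      ← mul_kronecker_mul, ← star_eq_conjTranspose, ← star_eq_conjTranspose]
    congr 2
    · exact (hρ α).spectral_theorem
    · exact hχ.spectral_theorem

theorem sum_negMulLog_mul {k m n : Type*} [Fintype k] [Fintype m] [Fintype n]
    (p : k → ℝ) (l : k → m → ℝ) (c : n → ℝ) (hp : ∑ α, p α = 1) (hl : ∀ α, ∑ i, l α i = 1)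
    (hc : ∑ j, c j = 1) :
    ∑ i : (m × n) × k, Real.negMulLog (p i.2 * (l i.2 i.1.1 * c i.1.2)) =
      ∑ α, Real.negMulLog (p α) + ∑ α, p α * ∑ i, Real.negMulLog (l α i)
        + ∑ j, Real.negMulLog (c j) := by
  rw [Fintype.sum_prod_type_right]
  simp only [Fintype.sum_prod_type, Real.negMulLog_mul, mul_add, Finset.sum_add_distrib,
    ← Finset.mul_sum, ← Finset.sum_mul, hp, hl, hc, one_mul, mul_one]
  ring

/-- Ryu–Takayanagi entropy decomposition: for the block-diagonal density matrix
`ρ_A = ⊕_α p α • (ρ α ⊗ₖ χ)` the von Neumann entropy is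
`S(ρ_A) = -Σ_α p_α log p_α + Σ_α p_α S(ρ_α) + S(χ)`. -/
theorem stmt_15 (K a b : ℕ) (p : Fin K → ℝ)
    (hp : ∀ α, 0 ≤ p α) (hp1 : ∑ α, p α = 1)
    (ρ : Fin K → Matrix (Fin a) (Fin a) ℂ)
    (hρ : ∀ α, (ρ α).PosSemidef) (hρ1 : ∀ α, (ρ α).trace = 1)
    (χ : Matrix (Fin b) (Fin b) ℂ) (hχ : χ.PosSemidef) (hχ1 : χ.trace = 1)
    (ρA : Matrix ((Fin a × Fin b) × Fin K) ((Fin a × Fin b) × Fin K) ℂ)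
    (hρA : ρA = Matrix.blockDiagonal (fun α => (p α : ℂ) • ((ρ α) ⊗ₖ χ)))
    (hA : ρA.IsHermitian) :
    ρA.PosSemidef ∧ ρA.trace = 1 ∧
      vnEntropy hA = ∑ α, Real.negMulLog (p α)
        + ∑ α, p α * vnEntropy (hρ α).isHermitian
        + vnEntropy hχ.isHermitian := by
  obtain ⟨U, hU, hdecomp⟩ := blockDiagonal_smul_kronecker_eq_mul_diagonal_mul p
    (fun α => (hρ α).isHermitian) hχ.isHermitian
  rw [← hρA] at hdecomp
  refine ⟨?_, ?_, ?_⟩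
  · rw [hdecomp]
    refine (PosSemidef.diagonal fun i => ?_).mul_mul_conjTranspose_same U
    exact Complex.zero_le_real.mpr (mul_nonneg (hp _)
      (mul_nonneg ((hρ _).eigenvalues_nonneg _) (hχ.eigenvalues_nonneg _)))
  · simp only [hρA, trace_blockDiagonal, trace_smul, trace_kronecker, hρ1, hχ1, smul_eq_mul,
      mul_one]
    exact_mod_cast hp1
  · rw [vnEntropy_eq_of_eq_mul_diagonal_mul hA _ hdecomp hU]
    exact sum_negMulLog_mul p (fun α => (hρ α).isHermitian.eigenvalues) _ hp1
      (fun α => sum_eigenvalues_eq_one_of_trace_eq_one _ (hρ1 α))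
      (sum_eigenvalues_eq_one_of_trace_eq_one _ hχ1)
end

section
/- Let c₁ c₂ : ℂ with |c₁|² + |c₂|² = 1, and define ψ : Fin 4 × Fin 4 → ℂ by ψ(0,0) = c₁/√2, ψ(3,3) = c₁/√2, ψ(1,1) = c₂/√2, ψ(2,2) = c₂/√2, and ψ(i,k) = 0 otherwise. Define the reduced density matrix ρ_A : Matrix (Fin 4) (Fin 4) ℂ by ρ_A i j = Σ_k ψ(i,k) * conj (ψ(j,k)). Then ρ_A = Matrix.diagonal ![|c₁|²/2, |c₂|²/2, |c₂|²/2, |c₁|²/2], and its von Neumann entropy equals Real.negMulLog |c₁|² + Real.negMulLog |c₂|² + Real.log 2. -/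
open Matrix

/-- The eigenvalues of a real diagonal matrix are its diagonal entries, with multiplicity. -/
theorem Matrix.IsHermitian.map_eigenvalues_diagonal {m : Type*} [Fintype m] [DecidableEq m]
    {d : m → ℝ} (h : (diagonal fun i => (d i : ℂ)).IsHermitian) :
    Finset.univ.val.map h.eigenvalues = Finset.univ.val.map d := by
  have hroots := h.roots_charpoly_eq_eigenvalues
  rw [charpoly_diagonal, Polynomial.roots_prod _ _
    (Finset.prod_ne_zero_iff.mpr fun i _ => Polynomial.X_sub_C_ne_zero _)] at hroots
  simp only [Polynomial.roots_X_sub_C, Multiset.bind_singleton] at hroots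
  apply Multiset.map_injective Complex.ofReal_injective
  simpa [Multiset.map_map, Function.comp_def] using hroots.symm

theorem vnEntropy_diagonal {m : Type*} [Fintype m] [DecidableEq m]
    {d : m → ℝ} (h : (diagonal fun i => (d i : ℂ)).IsHermitian) :
    vnEntropy h = ∑ i, Real.negMulLog (d i) := by
  have hsum := congrArg (fun s : Multiset ℝ => (s.map Real.negMulLog).sum)
    h.map_eigenvalues_diagonal
  simp only [Multiset.map_map] at hsum
  exact hsum

theorem Real.two_mul_negMulLog_half (t : ℝ) :
    2 * Real.negMulLog (t / 2) = Real.negMulLog t + t * Real.log 2 := by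
  rcases eq_or_ne t 0 with rfl | ht
  · simp
  · rw [Real.negMulLog, Real.negMulLog, Real.log_div ht two_ne_zero]
    ring

/-- The `[[4,1,2]]`-code example: for the state
`(c₁/√2)(|0000⟩+|1111⟩) + (c₂/√2)(|0101⟩+|1010⟩)`, the reduced density matrix of the
first two qubits is diagonal with entries `|c₁|²/2, |c₂|²/2, |c₂|²/2, |c₁|²/2`, and its
von Neumann entropy is `negMulLog |c₁|² + negMulLog |c₂|² + log 2`. -/
theorem stmt_17 (c₁ c₂ : ℂ) (hnorm : ‖c₁‖ ^ 2 + ‖c₂‖ ^ 2 = 1)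
    (ψ : Fin 4 × Fin 4 → ℂ)
    (hψ : ψ = fun p =>
      if p = ((0 : Fin 4), (0 : Fin 4)) then c₁ / (Real.sqrt 2 : ℂ)
      else if p = (3, 3) then c₁ / (Real.sqrt 2 : ℂ)
      else if p = (1, 1) then c₂ / (Real.sqrt 2 : ℂ)
      else if p = (2, 2) then c₂ / (Real.sqrt 2 : ℂ)
      else 0)
    (ρA : Matrix (Fin 4) (Fin 4) ℂ)
    (hρA : ρA = Matrix.of fun i j => ∑ k, ψ (i, k) * (starRingEnd ℂ) (ψ (j, k)))
    (hA : ρA.IsHermitian) :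
    ρA = Matrix.diagonal
        ![(‖c₁‖ ^ 2 / 2 : ℂ), (‖c₂‖ ^ 2 / 2 : ℂ), (‖c₂‖ ^ 2 / 2 : ℂ), (‖c₁‖ ^ 2 / 2 : ℂ)]
      ∧ vnEntropy hA
          = Real.negMulLog (‖c₁‖ ^ 2) + Real.negMulLog (‖c₂‖ ^ 2) + Real.log 2 := by
  have hsq : (Real.sqrt 2 : ℂ) * (Real.sqrt 2 : ℂ) = 2 := by
    rw [← Complex.ofReal_mul, Real.mul_self_sqrt zero_le_two, Complex.ofReal_ofNat]
  have hentry (c : ℂ) : c / (Real.sqrt 2 : ℂ) * (starRingEnd ℂ c / (Real.sqrt 2 : ℂ))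
      = (‖c‖ : ℂ) ^ 2 / 2 := by
    rw [div_mul_div_comm, hsq, Complex.mul_conj']
  have hdiag : ρA = Matrix.diagonal
      ![(‖c₁‖ ^ 2 / 2 : ℂ), (‖c₂‖ ^ 2 / 2 : ℂ), (‖c₂‖ ^ 2 / 2 : ℂ), (‖c₁‖ ^ 2 / 2 : ℂ)] := by
    subst hρA hψ
    ext i j
    fin_cases i <;> fin_cases j <;> simp [Fin.sum_univ_four, hentry]
  refine ⟨hdiag, ?_⟩
  let d : Fin 4 → ℝ := ![‖c₁‖ ^ 2 / 2, ‖c₂‖ ^ 2 / 2, ‖c₂‖ ^ 2 / 2, ‖c₁‖ ^ 2 / 2]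
  have hd : ρA = diagonal fun i => (d i : ℂ) := by
    rw [hdiag]
    congr 1
    ext i
    fin_cases i <;> simp [d]
  clear hρA hdiag
  subst hd
  rw [vnEntropy_diagonal]
  simp only [d, Fin.sum_univ_four, Matrix.cons_val]
  linear_combination Real.two_mul_negMulLog_half (‖c₁‖ ^ 2) +
    Real.two_mul_negMulLog_half (‖c₂‖ ^ 2) + Real.log 2 * hnorm
end
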